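/- Let L > 0 and let α, β, γ, δ, c, ε be real constants with γ ≠ 0. Suppose U, W : ℝ × ℝ → ℝ are five times continuously differentiable, satisfy the potential coupled Boussinesq system at every point, satisfy U(−L, t) = W(−L, t) = 0 for all t, and u := U_x and w := W_x are 2L-periodic in x for every t. Then for every t, d/dt ∫_{−L}^{L} ( U_t u + (δ/γ) W_t w + ε u_t u_x + (εβδ/γ) w_t w_x ) dx = (1/2)[ U_t(L,t)² + (δ/γ) W_t(L,t)² − εδ ( U(L,t) − W(L,t) )² ] (the nonlocal momentum conservation law). -/

import Mathlib

/-- Partial derivative in the first variable (space `x`). -/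
noncomputable def pd1 (f : ℝ → ℝ → ℝ) (x y : ℝ) : ℝ := deriv (fun x' => f x' y) x

/-- Partial derivative in the second variable (time `t`). -/
noncomputable def pd2 (f : ℝ → ℝ → ℝ) (x y : ℝ) : ℝ := deriv (fun y' => f x y') y

/-- The potential coupled Boussinesq system:
`U_tt − U_xx = ε[ U_x U_xx + U_ttxx − δ(U − W) ]`,
`W_tt − c² W_xx = ε[ α W_x W_xx + β W_ttxx + γ(U − W) ]`. -/
def potCB (α β γ δ c ε : ℝ) (U W : ℝ → ℝ → ℝ) : Prop :=
  ∀ x t : ℝ,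
    pd2 (pd2 U) x t - pd1 (pd1 U) x t
      = ε * (pd1 U x t * pd1 (pd1 U) x t + pd1 (pd1 (pd2 (pd2 U))) x t
          - δ * (U x t - W x t)) ∧
    pd2 (pd2 W) x t - c ^ 2 * pd1 (pd1 W) x t
      = ε * (α * pd1 W x t * pd1 (pd1 W) x t + β * pd1 (pd1 (pd2 (pd2 W))) x t
          + γ * (U x t - W x t))

open Function Set

/-- The first partial derivative is the total derivative evaluated at `(1, 0)`. -/
lemma hasDerivAt_fst_fderiv {f : ℝ → ℝ → ℝ} (hf : Differentiable ℝ (uncurry f)) (x y : ℝ) :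
    HasDerivAt (fun x' => f x' y) (fderiv ℝ (uncurry f) (x, y) (1, 0)) x :=
  (hf (x, y)).hasFDerivAt.comp_hasDerivAt (f := fun x' => (x', y)) x
    ((hasDerivAt_id x).prodMk (hasDerivAt_const x y))

/-- The second partial derivative is the total derivative evaluated at `(0, 1)`. -/
lemma hasDerivAt_snd_fderiv {f : ℝ → ℝ → ℝ} (hf : Differentiable ℝ (uncurry f)) (x y : ℝ) :
    HasDerivAt (fun y' => f x y') (fderiv ℝ (uncurry f) (x, y) (0, 1)) y :=
  (hf (x, y)).hasFDerivAt.comp_hasDerivAt (f := fun y' => (x, y')) y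
    ((hasDerivAt_const y x).prodMk (hasDerivAt_id y))

lemma uncurry_pd1 {f : ℝ → ℝ → ℝ} (hf : Differentiable ℝ (uncurry f)) :
    uncurry (pd1 f) = fun p => fderiv ℝ (uncurry f) p (1, 0) :=
  funext fun p => (hasDerivAt_fst_fderiv hf p.1 p.2).deriv

lemma uncurry_pd2 {f : ℝ → ℝ → ℝ} (hf : Differentiable ℝ (uncurry f)) :
    uncurry (pd2 f) = fun p => fderiv ℝ (uncurry f) p (0, 1) :=
  funext fun p => (hasDerivAt_snd_fderiv hf p.1 p.2).deriv

lemma hasDerivAt_pd1 {f : ℝ → ℝ → ℝ} (hf : Differentiable ℝ (uncurry f)) (x y : ℝ) :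
    HasDerivAt (fun x' => f x' y) (pd1 f x y) x :=
  (hasDerivAt_fst_fderiv hf x y).differentiableAt.hasDerivAt

lemma hasDerivAt_pd2 {f : ℝ → ℝ → ℝ} (hf : Differentiable ℝ (uncurry f)) (x y : ℝ) :
    HasDerivAt (fun y' => f x y') (pd2 f x y) y :=
  (hasDerivAt_snd_fderiv hf x y).differentiableAt.hasDerivAt

lemma contDiff_pd1 {f : ℝ → ℝ → ℝ} (n : ℕ) (hf : ContDiff ℝ (n + 1) (uncurry f)) :
    ContDiff ℝ n (uncurry (pd1 f)) := by
  rw [uncurry_pd1 (hf.differentiable (by simp))]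
  exact (hf.fderiv_right le_rfl).clm_apply contDiff_const

lemma contDiff_pd2 {f : ℝ → ℝ → ℝ} (n : ℕ) (hf : ContDiff ℝ (n + 1) (uncurry f)) :
    ContDiff ℝ n (uncurry (pd2 f)) := by
  rw [uncurry_pd2 (hf.differentiable (by simp))]
  exact (hf.fderiv_right le_rfl).clm_apply contDiff_const

/-- Mixed partial derivatives of a `C²` function commute. -/
lemma pd1_pd2_comm {f : ℝ → ℝ → ℝ} (hf : ContDiff ℝ 2 (uncurry f)) :
    pd1 (pd2 f) = pd2 (pd1 f) := by
  have hd : Differentiable ℝ (uncurry f) := hf.differentiable (by simp)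
  have hf' : Differentiable ℝ (fderiv ℝ (uncurry f)) :=
    (hf.fderiv_right (m := 1) le_rfl).differentiable (by simp)
  have key (v p : ℝ × ℝ) : HasFDerivAt (fun q => fderiv ℝ (uncurry f) q v)
      ((fderiv ℝ (fderiv ℝ (uncurry f)) p).flip v) p :=
    ((ContinuousLinearMap.apply ℝ ℝ v).hasFDerivAt).comp p (hf' p).hasFDerivAt
  have hsymm (p : ℝ × ℝ) : IsSymmSndFDerivAt ℝ (uncurry f) p :=
    hf.contDiffAt.isSymmSndFDerivAt (by simp)
  have d1 : Differentiable ℝ (uncurry (pd1 f)) := by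
    rw [uncurry_pd1 hd]; exact fun p => (key _ p).differentiableAt
  have d2 : Differentiable ℝ (uncurry (pd2 f)) := by
    rw [uncurry_pd2 hd]; exact fun p => (key _ p).differentiableAt
  funext x y
  change uncurry (pd1 (pd2 f)) (x, y) = uncurry (pd2 (pd1 f)) (x, y)
  rw [uncurry_pd1 d2, uncurry_pd2 d1, uncurry_pd1 hd, uncurry_pd2 hd]
  simp only [(key _ _).fderiv, ContinuousLinearMap.flip_apply]
  exact (hsymm (x, y)).eq _ _

/-- Differentiation under the integral sign over a compact interval. -/
lemma hasDerivAt_intervalIntegral_of_continuous {G G' : ℝ → ℝ → ℝ} (a b t : ℝ)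
    (hG : Continuous (uncurry G)) (hG' : Continuous (uncurry G'))
    (hd : ∀ x s, HasDerivAt (fun s => G x s) (G' x s) s) :
    HasDerivAt (fun s => ∫ x in a..b, G x s) (∫ x in a..b, G' x t) t := by
  have hGc (s : ℝ) : Continuous fun x => G x s := hG.comp (by fun_prop : Continuous fun x => (x, s))
  have hGc' : Continuous fun x => G' x t := hG'.comp (by fun_prop : Continuous fun x => (x, t))
  obtain ⟨C, hC⟩ := (isCompact_uIcc.prod (isCompact_closedBall t 1) :
    IsCompact (uIcc a b ×ˢ Metric.closedBall t 1)).exists_bound_of_continuousOn hG'.continuousOn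
  refine (intervalIntegral.hasDerivAt_integral_of_dominated_loc_of_deriv_le
    (F := fun s x => G x s) (F' := fun s x => G' x s) (bound := fun _ => C)
    (Metric.closedBall_mem_nhds t one_pos)
    (Filter.Eventually.of_forall fun s => (hGc s).aestronglyMeasurable)
    ((hGc t).intervalIntegrable a b) hGc'.aestronglyMeasurable
    (Filter.Eventually.of_forall fun x hx s hs => hC (x, s) ⟨uIoc_subset_uIcc hx, hs⟩)
    intervalIntegrable_const
    (Filter.Eventually.of_forall fun x _ s _ => hd x s)).2

/-- A local conservation law `G_t = F_x` integrated over `[a, b]`. -/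
lemma hasDerivAt_integral_of_conservation_law {G G' F : ℝ → ℝ → ℝ} (a b t : ℝ)
    (hG : Continuous (uncurry G)) (hG' : Continuous (uncurry G'))
    (hd : ∀ x s, HasDerivAt (fun s => G x s) (G' x s) s)
    (hF : ∀ x, HasDerivAt (fun x => F x t) (G' x t) x) :
    HasDerivAt (fun s => ∫ x in a..b, G x s) (F b t - F a t) t := by
  have hGc' : Continuous fun x => G' x t := hG'.comp (by fun_prop : Continuous fun x => (x, t))
  rw [← intervalIntegral.integral_eq_sub_of_hasDerivAt (f := fun x => F x t) (fun x _ => hF x)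
    (hGc'.intervalIntegrable a b)]
  exact hasDerivAt_intervalIntegral_of_continuous a b t hG hG' hd

/-- The momentum density `V_t v + k v_t v_x`, with `v = V_x`, of a single component. -/
noncomputable def momentumDensity (k : ℝ) (V : ℝ → ℝ → ℝ) (x t : ℝ) : ℝ :=
  pd2 V x t * pd1 V x t + k * pd2 (pd1 V) x t * pd1 (pd1 V) x t

/-- The time derivative of `momentumDensity`. -/
noncomputable def momentumDensityDt (k : ℝ) (V : ℝ → ℝ → ℝ) (x t : ℝ) : ℝ :=
  pd2 (pd2 V) x t * pd1 V x t + pd2 V x t * pd2 (pd1 V) x t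
    + k * (pd2 (pd2 (pd1 V)) x t * pd1 (pd1 V) x t
      + pd2 (pd1 V) x t * pd2 (pd1 (pd1 V)) x t)

/-- The momentum flux of a single component without coupling, for the equation
`V_tt = m V_xx + n V_x V_xx + k V_ttxx`. -/
noncomputable def momentumFlux (m n k : ℝ) (V : ℝ → ℝ → ℝ) (x t : ℝ) : ℝ :=
  m / 2 * pd1 V x t ^ 2 + n / 3 * pd1 V x t ^ 3 + pd2 V x t ^ 2 / 2
    + k * (pd2 (pd2 (pd1 V)) x t * pd1 V x t + pd2 (pd1 V) x t ^ 2 / 2)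

lemma continuous_momentumDensity {V : ℝ → ℝ → ℝ} (hV : ContDiff ℝ 5 (uncurry V))
    (k : ℝ) : Continuous (uncurry (momentumDensity k V)) := by
  have h1 := contDiff_pd1 4 hV
  have h2 := (contDiff_pd2 4 hV).continuous
  have h21 := (contDiff_pd2 3 h1).continuous
  have h11 := (contDiff_pd1 3 h1).continuous
  exact (h2.mul h1.continuous).add ((h21.const_mul k).mul h11)

lemma continuous_momentumDensityDt {V : ℝ → ℝ → ℝ} (hV : ContDiff ℝ 5 (uncurry V))
    (k : ℝ) : Continuous (uncurry (momentumDensityDt k V)) := by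
  have h1 := contDiff_pd1 4 hV
  have h2 := contDiff_pd2 4 hV
  have h21 := contDiff_pd2 3 h1
  have h11 := contDiff_pd1 3 h1
  have h22 := contDiff_pd2 3 h2
  have h221 := contDiff_pd2 2 h21
  have h211 := contDiff_pd2 2 h11
  exact ((h22.continuous.mul h1.continuous).add (h2.continuous.mul h21.continuous)).add
    (((h221.continuous.mul h11.continuous).add
      (h21.continuous.mul h211.continuous)).const_mul k)

lemma hasDerivAt_momentumDensity {V : ℝ → ℝ → ℝ} (hV : ContDiff ℝ 5 (uncurry V))
    (k x t : ℝ) :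
    HasDerivAt (fun s => momentumDensity k V x s) (momentumDensityDt k V x t) t := by
  have h1 := contDiff_pd1 4 hV
  have h2 := contDiff_pd2 4 hV
  have d1 := hasDerivAt_pd2 (h1.differentiable (by simp)) x t
  have d2 := hasDerivAt_pd2 (h2.differentiable (by simp)) x t
  have d21 := hasDerivAt_pd2 ((contDiff_pd2 3 h1).differentiable (by simp)) x t
  have d11 := hasDerivAt_pd2 ((contDiff_pd1 3 h1).differentiable (by simp)) x t
  refine ((d2.mul d1).add ((d21.const_mul k).mul d11)).congr_deriv ?_
  simp only [momentumDensityDt]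
  ring

/-- The flux derivative is `momentumDensityDt` minus the residual of the equation times `V_x`. -/
lemma hasDerivAt_momentumFlux {V : ℝ → ℝ → ℝ} (hV : ContDiff ℝ 5 (uncurry V))
    (m n k x t : ℝ) :
    HasDerivAt (fun y => momentumFlux m n k V y t)
      (momentumDensityDt k V x t - (pd2 (pd2 V) x t - m * pd1 (pd1 V) x t
        - n * pd1 V x t * pd1 (pd1 V) x t - k * pd1 (pd1 (pd2 (pd2 V))) x t) * pd1 V x t) x := by
  have h1 := contDiff_pd1 4 hV
  have h2 := contDiff_pd2 4 hV
  have h21 := contDiff_pd2 3 h1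
  have d1 := hasDerivAt_pd1 (h1.differentiable (by simp)) x t
  have d2 := hasDerivAt_pd1 (h2.differentiable (by simp)) x t
  have d21 := hasDerivAt_pd1 (h21.differentiable (by simp)) x t
  have d221 := hasDerivAt_pd1 ((contDiff_pd2 2 h21).differentiable (by simp)) x t
  have c : pd1 (pd2 V) = pd2 (pd1 V) := pd1_pd2_comm (hV.of_le (by norm_num))
  have c1 : pd1 (pd2 (pd1 V)) = pd2 (pd1 (pd1 V)) := pd1_pd2_comm (h1.of_le (by norm_num))
  have c2 : pd1 (pd2 (pd2 V)) = pd2 (pd2 (pd1 V)) := by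
    rw [pd1_pd2_comm (h2.of_le (by norm_num)), c]
  rw [c] at d2
  rw [c1] at d21
  refine (((((d1.pow 2).const_mul (m / 2)).add ((d1.pow 3).const_mul (n / 3))).add
    ((d2.pow 2).div_const 2)).add
    (((d221.mul d1).add ((d21.pow 2).div_const 2)).const_mul k)).congr_deriv ?_
  rw [c2]
  simp only [momentumDensityDt]
  push_cast
  ring

/-- Periodicity of `V_x` and `V(-L, ·) = 0` leave only `V_t(L, t)² / 2` of the flux difference. -/
lemma momentumFlux_sub_momentumFlux {V : ℝ → ℝ → ℝ} {L : ℝ} (hb : ∀ t, V (-L) t = 0)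
    (hp : ∀ x t, pd1 V (x + 2 * L) t = pd1 V x t) (m n k t : ℝ) :
    momentumFlux m n k V L t - momentumFlux m n k V (-L) t = pd2 V L t ^ 2 / 2 := by
  have e1 : pd1 V L = pd1 V (-L) := funext fun s => by
    rw [← hp (-L) s]; congr 1; ring
  have e21 : pd2 (pd1 V) L = pd2 (pd1 V) (-L) := funext fun s => by simp only [pd2, e1]
  have e221 : pd2 (pd2 (pd1 V)) L t = pd2 (pd2 (pd1 V)) (-L) t := by
    rw [pd2, pd2, e21]
  have e2 : pd2 V (-L) t = 0 := by simp [pd2, hb]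
  simp only [momentumFlux, e1, e21, e221, e2]
  ring

/-- Nonlocal momentum conservation law for C⁵ solutions of the potential coupled
Boussinesq system with `U(−L,t) = W(−L,t) = 0` and `u = U_x`, `w = W_x`
`2L`-periodic in `x`. -/
theorem stmt11 (L α β γ δ c ε : ℝ) (hL : 0 < L) (hγ : γ ≠ 0) (U W : ℝ → ℝ → ℝ)
    (hU : ContDiff ℝ 5 (Function.uncurry U)) (hW : ContDiff ℝ 5 (Function.uncurry W))
    (hsys : potCB α β γ δ c ε U W)
    (hUb : ∀ t, U (-L) t = 0) (hWb : ∀ t, W (-L) t = 0)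
    (hup : ∀ x t, pd1 U (x + 2 * L) t = pd1 U x t)
    (hwp : ∀ x t, pd1 W (x + 2 * L) t = pd1 W x t) :
    ∀ t : ℝ,
      deriv (fun s => ∫ x in (-L)..L,
          (pd2 U x s * pd1 U x s + (δ / γ) * pd2 W x s * pd1 W x s
            + ε * pd2 (pd1 U) x s * pd1 (pd1 U) x s
            + (ε * β * δ / γ) * pd2 (pd1 W) x s * pd1 (pd1 W) x s)) t
        = (1 / 2) * ((pd2 U L t) ^ 2 + (δ / γ) * (pd2 W L t) ^ 2
            - ε * δ * (U L t - W L t) ^ 2) := by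
  intro t
  have hcoup (x : ℝ) : HasDerivAt (fun y => (U y t - W y t) ^ 2)
      (2 * (U x t - W x t) * (pd1 U x t - pd1 W x t)) x := by
    refine (((hasDerivAt_pd1 (hU.differentiable (by simp)) x t).sub
      (hasDerivAt_pd1 (hW.differentiable (by simp)) x t)).pow 2).congr_deriv ?_
    simp
  have key := hasDerivAt_integral_of_conservation_law (-L) L t
    (G := fun x s => momentumDensity ε U x s + δ / γ * momentumDensity (ε * β) W x s)
    (G' := fun x s => momentumDensityDt ε U x s + δ / γ * momentumDensityDt (ε * β) W x s)
    (F := fun x s => momentumFlux 1 ε ε U x s + δ / γ * momentumFlux (c ^ 2) (ε * α) (ε * β) W x s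
      - ε * δ / 2 * (U x s - W x s) ^ 2)
    ((continuous_momentumDensity hU ε).add
      ((continuous_momentumDensity hW (ε * β)).const_mul (δ / γ)))
    ((continuous_momentumDensityDt hU ε).add
      ((continuous_momentumDensityDt hW (ε * β)).const_mul (δ / γ)))
    (fun x s => (hasDerivAt_momentumDensity hU ε x s).add
      ((hasDerivAt_momentumDensity hW (ε * β) x s).const_mul (δ / γ)))
    (fun x => by
      refine (((hasDerivAt_momentumFlux hU 1 ε ε x t).add
        ((hasDerivAt_momentumFlux hW (c ^ 2) (ε * α) (ε * β) x t).const_mul (δ / γ))).sub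
        ((hcoup x).const_mul (ε * δ / 2))).congr_deriv ?_
      obtain ⟨h₁, h₂⟩ := hsys x t
      have hδ : δ / γ * γ = δ := div_mul_cancel₀ δ hγ
      linear_combination -pd1 U x t * h₁ - δ / γ * pd1 W x t * h₂
        - ε * (U x t - W x t) * pd1 W x t * hδ)
  have hint : (fun s => ∫ x in (-L)..L,
      (pd2 U x s * pd1 U x s + (δ / γ) * pd2 W x s * pd1 W x s
        + ε * pd2 (pd1 U) x s * pd1 (pd1 U) x s
        + (ε * β * δ / γ) * pd2 (pd1 W) x s * pd1 (pd1 W) x s)) =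
      fun s => ∫ x in (-L)..L,
        (momentumDensity ε U x s + δ / γ * momentumDensity (ε * β) W x s) := by
    funext s
    congr 1
    funext x
    simp only [momentumDensity]
    ring
  rw [hint, key.deriv, hUb, hWb]
  linear_combination momentumFlux_sub_momentumFlux hUb hup 1 ε ε t
    + δ / γ * momentumFlux_sub_momentumFlux hWb hwp (c ^ 2) (ε * α) (ε * β) t
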